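/- The self-dual 4-form μ := e^{1234}−e^{1256}+e^{1278}+e^{1357}+e^{1467}+e^{1368}+e^{1458} on ℝ⁸ has comass exactly 2. -/

import Mathlib

noncomputable section

open scoped BigOperators
open Matrix

/-- `ℝ⁸` with its standard Euclidean structure. -/
abbrev E8 : Type := EuclideanSpace ℝ (Fin 8)

/-- The standard orthonormal basis `e₁, …, e₈` of `ℝ⁸`. -/
def stdB : Fin 8 → E8 := fun i => EuclideanSpace.single i 1

/-- The `j`-th coordinate functional `eʲ`. -/
def coordL (j : Fin 8) : E8 →ₗ[ℝ] ℝ :=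
  (LinearMap.proj j).comp (WithLp.linearEquiv 2 ℝ (Fin 8 → ℝ)).toLinearMap

/-- Alternating 4-forms on `ℝ⁸`. -/
abbrev Form4 : Type := AlternatingMap ℝ E8 ℝ (Fin 4)

/-- The decomposable 4-form `eᵃ∧eᵇ∧eᶜ∧eᵈ` (value `det` of the coordinates). -/
def wedge4 (a b c d : Fin 8) : Form4 :=
  (Matrix.detRowAlternating : AlternatingMap ℝ (Fin 4 → ℝ) ℝ (Fin 4)).compLinearMap
    (LinearMap.pi (fun i : Fin 4 => coordL (![a, b, c, d] i)))

/-- The comass `‖ω‖` of a 4-form: the sup of values on unit vectors. -/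
def comass (ω : Form4) : ℝ :=
  sSup {r : ℝ | ∃ v : Fin 4 → E8, (∀ i, ‖v i‖ = 1) ∧ ω v = r}

open scoped Classical in
/-- The square `|ω|²` of the Euclidean norm of a 4-form:
the sum of the squares of the coefficients over increasing multi-indices. -/
def eNormSq (ω : Form4) : ℝ :=
  ∑ f ∈ Finset.univ.filter (fun f : Fin 4 → Fin 8 => StrictMono f),
    (ω (fun i => stdB (f i))) ^ 2

/-- `e^{1234}` (1-indexed), i.e. `e¹∧e²∧e³∧e⁴` plus its Hodge dual. -/
def E1234 : Form4 := wedge4 0 1 2 3 + wedge4 4 5 6 7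
def E1256 : Form4 := wedge4 0 1 4 5 + wedge4 2 3 6 7
def E1278 : Form4 := wedge4 0 1 6 7 + wedge4 2 3 4 5
def E1357 : Form4 := wedge4 0 2 4 6 + wedge4 1 3 5 7
def E1467 : Form4 := wedge4 0 3 5 6 + wedge4 1 2 4 7
def E1368 : Form4 := wedge4 0 2 5 7 + wedge4 1 3 4 6
def E1458 : Form4 := wedge4 0 3 4 7 + wedge4 1 2 5 6

/-- The Cayley form. -/
def cay : Form4 := E1234 + E1256 + E1278 + E1357 - E1368 - E1458 - E1467

/-- A 4-form on `ℝ⁸` is self-dual if `ω(e_f) = ω(e_g)` whenever `f`, `g` are complementary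
increasing multi-indices whose concatenation is an even permutation of `(1,…,8)`
(i.e. induces the standard orientation). -/
def SelfDual (ω : Form4) : Prop :=
  ∀ (f g : Fin 4 → Fin 8) (σ : Equiv.Perm (Fin 8)),
    StrictMono f → StrictMono g →
    (∀ i : Fin 8, σ i = Fin.append f g (Fin.cast (by norm_num) i)) →
    Equiv.Perm.sign σ = 1 →
    ω (fun i => stdB (f i)) = ω (fun i => stdB (g i))

/-- Membership in `SO(8)`, as real `8 × 8` matrices. -/
def IsSO8 (g : Matrix (Fin 8) (Fin 8) ℝ) : Prop := g * gᵀ = 1 ∧ g.det = 1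

/-- The linear action of an `8 × 8` matrix on `ℝ⁸`. -/
def mulVecL (g : Matrix (Fin 8) (Fin 8) ℝ) : E8 →ₗ[ℝ] E8 :=
  (WithLp.linearEquiv 2 ℝ (Fin 8 → ℝ)).symm.toLinearMap ∘ₗ
    g.mulVecLin ∘ₗ (WithLp.linearEquiv 2 ℝ (Fin 8 → ℝ)).toLinearMap

/-- The action of a matrix `g` on 4-forms: `(g·ω)(v₁,…,v₄) = ω(g⁻¹v₁,…,g⁻¹v₄)`. -/
def formAct (g : Matrix (Fin 8) (Fin 8) ℝ) (ω : Form4) : Form4 :=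
  ω.compLinearMap (mulVecL g⁻¹)

/-- Two 4-forms are `SO(8)`-conjugate if they lie in the same orbit. -/
def SOConj (ω η : Form4) : Prop := ∃ g, IsSO8 g ∧ formAct g ω = η

/-- The form `μ`. -/
def muForm : Form4 := E1234 - E1256 + E1278 + E1357 + E1467 + E1368 + E1458

/-- Value of a decomposable form: the `4 × 4` minor in the chosen columns. -/
theorem wedge4_apply (a b c d : Fin 8) (v : Fin 4 → E8) :
    wedge4 a b c d v = Matrix.det (Matrix.of fun i j : Fin 4 => v i (![a, b, c, d] j)) := rfl

/-- Laplace expansion of a decomposable form along the first two vectors. -/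
theorem wedge4_eq (a b c d : Fin 8) (v : Fin 4 → E8) :
    wedge4 a b c d v =
      (v 0 a * v 1 b - v 0 b * v 1 a) * (v 2 c * v 3 d - v 2 d * v 3 c)
      - (v 0 a * v 1 c - v 0 c * v 1 a) * (v 2 b * v 3 d - v 2 d * v 3 b)
      + (v 0 a * v 1 d - v 0 d * v 1 a) * (v 2 b * v 3 c - v 2 c * v 3 b)
      + (v 0 b * v 1 c - v 0 c * v 1 b) * (v 2 a * v 3 d - v 2 d * v 3 a)
      - (v 0 b * v 1 d - v 0 d * v 1 b) * (v 2 a * v 3 c - v 2 c * v 3 a)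
      + (v 0 c * v 1 d - v 0 d * v 1 c) * (v 2 a * v 3 b - v 2 b * v 3 a) := by
  rw [wedge4_apply, Matrix.det_succ_row_zero]
  simp only [Matrix.det_fin_three, Fin.sum_univ_four, Matrix.submatrix_apply, Matrix.of_apply]
  simp [Fin.succAbove, Fin.ext_iff]
  ring

/-- Rescaling the coordinates of `ℝ⁸` by `s`. -/
def coordScale (s : Fin 8 → ℝ) (x : E8) : E8 := WithLp.toLp 2 fun i => s i * x i

theorem norm_coordScale {s : Fin 8 → ℝ} (hs : ∀ i, s i ^ 2 = 1) (x : E8) :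
    ‖coordScale s x‖ = ‖x‖ := by
  rw [← sq_eq_sq₀ (norm_nonneg _) (norm_nonneg _), EuclideanSpace.real_norm_sq_eq,
    EuclideanSpace.real_norm_sq_eq]
  exact Finset.sum_congr rfl fun i _ => by simp [coordScale, mul_pow, hs]

theorem wedge4_coordScale (a b c d : Fin 8) (s : Fin 8 → ℝ) (v : Fin 4 → E8) :
    wedge4 a b c d (fun i => coordScale s (v i)) = s a * s b * s c * s d * wedge4 a b c d v := by
  have h := Matrix.det_mul_row (fun j : Fin 4 => s (![a, b, c, d] j))
    (Matrix.of fun i j : Fin 4 => v i (![a, b, c, d] j))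
  rw [wedge4_apply, wedge4_apply]
  simpa [Fin.prod_univ_four, coordScale] using h

/-- Octonion multiplication on `ℝ⁸`, with unit `e₁`. -/
def octMul (a b : E8) : E8 := !₂[
  a 0 * b 0 - a 1 * b 1 - a 2 * b 2 - a 3 * b 3 - a 4 * b 4 - a 5 * b 5 - a 6 * b 6 - a 7 * b 7,
  a 0 * b 1 + a 1 * b 0 + a 2 * b 3 - a 3 * b 2 + a 4 * b 5 - a 5 * b 4 + a 6 * b 7 - a 7 * b 6,
  a 0 * b 2 - a 1 * b 3 + a 2 * b 0 + a 3 * b 1 + a 4 * b 6 - a 5 * b 7 - a 6 * b 4 + a 7 * b 5,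
  a 0 * b 3 + a 1 * b 2 - a 2 * b 1 + a 3 * b 0 - a 4 * b 7 - a 5 * b 6 + a 6 * b 5 + a 7 * b 4,
  a 0 * b 4 - a 1 * b 5 - a 2 * b 6 + a 3 * b 7 + a 4 * b 0 + a 5 * b 1 + a 6 * b 2 - a 7 * b 3,
  a 0 * b 5 + a 1 * b 4 + a 2 * b 7 + a 3 * b 6 - a 4 * b 1 + a 5 * b 0 - a 6 * b 3 - a 7 * b 2,
  a 0 * b 6 - a 1 * b 7 + a 2 * b 4 - a 3 * b 5 - a 4 * b 2 + a 5 * b 3 + a 6 * b 0 + a 7 * b 1,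
  a 0 * b 7 + a 1 * b 6 - a 2 * b 5 - a 3 * b 4 + a 4 * b 3 + a 5 * b 2 - a 6 * b 1 + a 7 * b 0]

/-- Octonion conjugation. -/
def octConj (a : E8) : E8 := coordScale ![1, -1, -1, -1, -1, -1, -1, -1] a

/-- The eight-square identity. -/
theorem norm_octMul (a b : E8) : ‖octMul a b‖ = ‖a‖ * ‖b‖ := by
  rw [← sq_eq_sq₀ (norm_nonneg _) (by positivity), mul_pow]
  simp only [EuclideanSpace.real_norm_sq_eq, Fin.sum_univ_eight, octMul]
  simp
  ring

theorem norm_octConj (a : E8) : ‖octConj a‖ = ‖a‖ :=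
  norm_coordScale (fun i => by fin_cases i <;> simp) a

/-- The Cayley form is the fully skew part of `⟪x, (y z̄) w⟫`. -/
theorem inner_octMul_eq_cay (v : Fin 4 → E8) :
    inner ℝ (v 0) (octMul (octMul (v 1) (octConj (v 2))) (v 3)) =
      cay v + inner ℝ (v 1) (v 2) * inner ℝ (v 0) (v 3)
        - inner ℝ (v 1) (v 3) * inner ℝ (v 0) (v 2)
        + inner ℝ (v 2) (v 3) * inner ℝ (v 0) (v 1) := by
  simp only [cay, E1234, E1256, E1278, E1357, E1368, E1458, E1467, AlternatingMap.add_apply,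
    AlternatingMap.sub_apply, wedge4_eq, PiLp.inner_apply, Fin.sum_univ_eight, octMul, octConj,
    coordScale]
  simp
  ring

theorem abs_cay_le_of_orthogonal (v : Fin 4 → E8) (h₁₂ : inner ℝ (v 1) (v 2) = 0)
    (h₁₃ : inner ℝ (v 1) (v 3) = 0) (h₂₃ : inner ℝ (v 2) (v 3) = 0) :
    |cay v| ≤ ∏ i, ‖v i‖ := by
  have h := inner_octMul_eq_cay v
  simp only [h₁₂, h₁₃, h₂₃, zero_mul, add_zero, sub_zero] at h
  rw [← h]
  refine (abs_real_inner_le_norm _ _).trans_eq ?_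
  simp only [norm_octMul, norm_octConj, Fin.prod_univ_four]
  ring

/-- The component of `w` orthogonal to `y`. -/
def orthPart (y w : E8) : E8 := w - (inner ℝ y w / inner ℝ y y) • y

theorem inner_orthPart (y w : E8) : inner ℝ y (orthPart y w) = 0 := by
  rcases eq_or_ne y 0 with rfl | hy
  · simp
  · have : inner ℝ y y ≠ (0 : ℝ) := inner_self_ne_zero.mpr hy
    rw [orthPart, inner_sub_right, inner_smul_right, div_mul_cancel₀ _ this, sub_self]

theorem norm_orthPart_le (y w : E8) : ‖orthPart y w‖ ≤ ‖w‖ := by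
  have h : inner ℝ (orthPart y w) ((inner ℝ y w / inner ℝ y y) • y) = (0 : ℝ) := by
    rw [inner_smul_right, real_inner_comm y (orthPart y w), inner_orthPart, mul_zero]
  have h2 := norm_add_sq_eq_norm_sq_add_norm_sq_of_inner_eq_zero _ _ h
  have h3 : orthPart y w + (inner ℝ y w / inner ℝ y y) • y = w := sub_add_cancel _ _
  rw [h3] at h2
  nlinarith [norm_nonneg w, norm_nonneg (orthPart y w),
    mul_self_nonneg ‖(inner ℝ y w / inner ℝ y y) • y‖]

theorem inner_orthPart_of_inner_eq_zero {x y w : E8} (hy : inner ℝ x y = 0)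
    (hw : inner ℝ x w = 0) : inner ℝ x (orthPart y w) = 0 := by
  rw [orthPart, inner_sub_right, inner_smul_right, hy, hw, mul_zero, sub_zero]

theorem map_update_orthPart (ω : Form4) (v : Fin 4 → E8) {i j : Fin 4} (hij : i ≠ j) :
    ω (Function.update v j (orthPart (v i) (v j))) = ω v := by
  rw [orthPart, AlternatingMap.map_update_sub, AlternatingMap.map_update_smul,
    AlternatingMap.map_update_self _ _ hij.symm, Function.update_eq_self, smul_zero, sub_zero]

/-- The Cayley form has comass at most `1`. -/
theorem abs_cay_le (v : Fin 4 → E8) : |cay v| ≤ ∏ i, ‖v i‖ := by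
  set z := orthPart (v 1) (v 2)
  set w := orthPart (v 1) (v 3)
  have h1 : cay ![v 0, v 1, z, v 3] = cay v := by
    rw [← map_update_orthPart cay v (show (1 : Fin 4) ≠ 2 by decide)]
    congr 1; ext i; fin_cases i <;> rfl
  have h2 : cay ![v 0, v 1, z, w] = cay ![v 0, v 1, z, v 3] := by
    rw [← map_update_orthPart cay ![v 0, v 1, z, v 3] (show (1 : Fin 4) ≠ 3 by decide)]
    congr 1; ext i; fin_cases i <;> rfl
  have h3 : cay ![v 0, v 1, z, orthPart z w] = cay ![v 0, v 1, z, w] := by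
    rw [← map_update_orthPart cay ![v 0, v 1, z, w] (show (2 : Fin 4) ≠ 3 by decide)]
    congr 1; ext i; fin_cases i <;> rfl
  rw [← h1, ← h2, ← h3]
  refine (abs_cay_le_of_orthogonal _ (inner_orthPart _ _)
    (inner_orthPart_of_inner_eq_zero (inner_orthPart _ _) (inner_orthPart _ _))
    (inner_orthPart _ _)).trans ?_
  simp only [Fin.prod_univ_four]
  have hzn : ‖z‖ ≤ ‖v 2‖ := norm_orthPart_le _ _
  have hwn : ‖orthPart z w‖ ≤ ‖v 3‖ := (norm_orthPart_le _ _).trans (norm_orthPart_le _ _)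
  show ‖v 0‖ * ‖v 1‖ * ‖z‖ * ‖orthPart z w‖ ≤ _
  gcongr

/-- The form `μ` is half a signed sum of four reflected Cayley forms. -/
theorem two_mul_muForm (v : Fin 4 → E8) :
    2 * muForm v = cay (fun i => coordScale ![-1, -1, 1, 1, 1, 1, 1, 1] (v i))
      + cay (fun i => coordScale ![-1, 1, -1, 1, 1, 1, 1, 1] (v i))
      + cay (fun i => coordScale ![-1, 1, 1, 1, 1, 1, -1, 1] (v i))
      - cay (fun i => coordScale ![-1, 1, 1, 1, 1, -1, 1, 1] (v i)) := by
  simp only [muForm, cay, E1234, E1256, E1278, E1357, E1368, E1458, E1467,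
    AlternatingMap.add_apply, AlternatingMap.sub_apply, wedge4_coordScale]
  simp
  ring

theorem muForm_le (v : Fin 4 → E8) : muForm v ≤ 2 * ∏ i, ‖v i‖ := by
  have key (s : Fin 8 → ℝ) (hs : ∀ i, s i ^ 2 = 1) :
      |cay (fun i => coordScale s (v i))| ≤ ∏ i, ‖v i‖ := by
    simpa only [norm_coordScale hs] using abs_cay_le fun i => coordScale s (v i)
  have h := two_mul_muForm v
  have h1 := abs_le.mp (key ![-1, -1, 1, 1, 1, 1, 1, 1] fun i => by fin_cases i <;> simp)
  have h2 := abs_le.mp (key ![-1, 1, -1, 1, 1, 1, 1, 1] fun i => by fin_cases i <;> simp)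
  have h3 := abs_le.mp (key ![-1, 1, 1, 1, 1, 1, -1, 1] fun i => by fin_cases i <;> simp)
  have h4 := abs_le.mp (key ![-1, 1, 1, 1, 1, -1, 1, 1] fun i => by fin_cases i <;> simp)
  linarith [h1.2, h2.2, h3.2, h4.1]

/-- An orthogonal frame, with vectors of length `√2`, spanning a plane calibrated by `μ / 2`. -/
def maxFrame : Fin 4 → E8 := ![!₂[1, 1, 0, 0, 0, 0, 0, 0], !₂[0, 0, 1, 1, 0, 0, 0, 0],
  !₂[0, 0, 0, 0, 1, 1, 0, 0], !₂[0, 0, 0, 0, 0, 0, 1, 1]]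

theorem norm_maxFrame (i : Fin 4) : ‖maxFrame i‖ = √2 := by
  fin_cases i <;> simp [maxFrame, EuclideanSpace.norm_eq, Fin.sum_univ_eight] <;> norm_num

theorem muForm_maxFrame : muForm maxFrame = 8 := by
  simp only [muForm, E1234, E1256, E1278, E1357, E1368, E1458, E1467,
    AlternatingMap.add_apply, AlternatingMap.sub_apply, wedge4_eq, maxFrame]
  simp
  norm_num

/-- The form `μ` has comass exactly `2`. -/
theorem muForm_comass_two : comass muForm = 2 := by
  refine IsGreatest.csSup_eq ⟨⟨fun i => (√2)⁻¹ • maxFrame i, fun i => ?_, ?_⟩, ?_⟩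
  · rw [norm_smul, norm_maxFrame, norm_inv, Real.norm_of_nonneg (Real.sqrt_nonneg 2),
      inv_mul_cancel₀ (by positivity)]
  · have h4 : (√2) ^ 4 = 4 := by
      rw [show (√2) ^ 4 = ((√2) ^ 2) ^ 2 by ring, Real.sq_sqrt (by norm_num)]; norm_num
    rw [AlternatingMap.map_smul_univ, muForm_maxFrame, Finset.prod_const, Finset.card_univ,
      Fintype.card_fin, inv_pow, h4]
    norm_num
  · rintro _ ⟨v, hv, rfl⟩
    simpa [hv] using muForm_le v
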